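/- (Concavity of the sandwiched Augustin auxiliary function E_0^{(2),*}(s,P) on (−1,0).) The map s ↦ s·I^{(2),*}_{1/(1+s)}(P,W) is concave on the interval (−1,0); note that 1/(1+s) ∈ (1,∞) for s ∈ (−1,0). -/

import Mathlib

open Matrix
open scoped ComplexOrder

/-- Real power of a (hermitian) matrix via the continuous functional calculus. -/
noncomputable def mpow {ι : Type*} [Fintype ι] [DecidableEq ι]
    (A : Matrix ι ι ℂ) (r : ℝ) : Matrix ι ι ℂ :=
  cfc (fun x : ℝ => x ^ r) A

/-- Logarithm of a (hermitian) matrix via the continuous functional calculus. -/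
noncomputable def mlog {ι : Type*} [Fintype ι] [DecidableEq ι]
    (A : Matrix ι ι ℂ) : Matrix ι ι ℂ :=
  cfc Real.log A

/-- Real part of the trace. -/
noncomputable def trR {ι : Type*} [Fintype ι] (A : Matrix ι ι ℂ) : ℝ :=
  (Matrix.trace A).re

/-- Positive definite density matrices. -/
def Dens (d : ℕ) : Type :=
  {σ : Matrix (Fin d) (Fin d) ℂ // σ.PosDef ∧ σ.trace = 1}

/-- Sandwiched Rényi divergence of order `α ≠ 1`. -/
noncomputable def Dsand {d : ℕ} (α : ℝ) (ρ σ : Matrix (Fin d) (Fin d) ℂ) : ℝ :=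
  (1 / (α - 1)) * Real.log
    (trR (mpow (mpow σ ((1 - α) / (2 * α)) * ρ * mpow σ ((1 - α) / (2 * α))) α))

/-- Sandwiched Augustin information (order `α ≠ 1`). -/
noncomputable def sandwichedAugustinInfo {d n : ℕ} (α : ℝ)
    (W : Fin n → Matrix (Fin d) (Fin d) ℂ) (P : Fin n → ℝ) : ℝ :=
  ⨅ σ : Dens d, ∑ i, P i * Dsand α (W i) σ.1

section

variable {ι : Type*} [Fintype ι] [DecidableEq ι]

theorem continuousOn_spectrum_matrix (f : ℝ → ℝ) (A : Matrix ι ι ℂ) :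
    ContinuousOn f (spectrum ℝ A) :=
  A.finite_real_spectrum.continuousOn f

theorem Matrix.PosDef.pos_of_mem_spectrum {A : Matrix ι ι ℂ} (hA : A.PosDef) {x : ℝ}
    (hx : x ∈ spectrum ℝ A) : 0 < x := by
  rw [hA.1.spectrum_real_eq_range_eigenvalues] at hx
  obtain ⟨i, rfl⟩ := hx
  exact hA.eigenvalues_pos i

theorem mpow_posDef {A : Matrix ι ι ℂ} (hA : A.PosDef) (r : ℝ) : (mpow A r).PosDef := by
  have h : (mpow A r).IsHermitian := cfc_predicate (R := ℝ) (fun x : ℝ => x ^ r) A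
  rw [h.posDef_iff_eigenvalues_pos]
  intro i
  have hi := h.eigenvalues_mem_spectrum_real i
  generalize h.eigenvalues i = x at hi
  rw [mpow, cfc_map_spectrum (R := ℝ) _ A hA.1.isSelfAdjoint (continuousOn_spectrum_matrix _ A)] at hi
  obtain ⟨y, hy, rfl⟩ := hi
  exact Real.rpow_pos_of_pos (hA.pos_of_mem_spectrum hy) r

theorem mpow_zero {A : Matrix ι ι ℂ} (hA : A.PosDef) : mpow A 0 = 1 := by
  simp only [mpow, Real.rpow_zero]
  exact cfc_const_one ℝ A hA.1

theorem mpow_one {A : Matrix ι ι ℂ} (hA : A.PosDef) : mpow A 1 = A := by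
  simp only [mpow, Real.rpow_one]
  exact cfc_id' ℝ A hA.1

theorem mpow_mul_mpow {A : Matrix ι ι ℂ} (hA : A.PosDef) (r t : ℝ) :
    mpow A r * mpow A t = mpow A (r + t) := by
  rw [mpow, mpow, ← cfc_mul _ _ A (continuousOn_spectrum_matrix _ A)
    (continuousOn_spectrum_matrix _ A)]
  exact cfc_congr fun x hx => (Real.rpow_add (hA.pos_of_mem_spectrum hx) r t).symm

theorem mpow_mpow {A : Matrix ι ι ℂ} (hA : A.PosDef) (r t : ℝ) :
    mpow (mpow A r) t = mpow A (r * t) := by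
  rw [mpow, mpow, ← cfc_comp' _ _ A ((A.finite_real_spectrum.image _).continuousOn _)
    (continuousOn_spectrum_matrix _ A) hA.1.isSelfAdjoint]
  exact cfc_congr fun x hx => (Real.rpow_mul (hA.pos_of_mem_spectrum hx).le r t).symm

theorem mpow_smul {A : Matrix ι ι ℂ} (hA : A.PosDef) {c : ℝ} (hc : 0 ≤ c) (r : ℝ) :
    mpow (c • A) r = c ^ r • mpow A r := by
  have h := cfc_comp_smul (R := ℝ) c (fun x : ℝ => x ^ r) A
    ((A.finite_real_spectrum.image _).continuousOn _) hA.1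
  rw [mpow, mpow, ← h, ← cfc_smul _ _ A (continuousOn_spectrum_matrix _ A)]
  refine cfc_congr fun x hx => ?_
  simp only [smul_eq_mul]
  exact Real.mul_rpow hc (hA.pos_of_mem_spectrum hx).le

theorem trR_mpow {A : Matrix ι ι ℂ} (hA : A.IsHermitian) (r : ℝ) :
    trR (mpow A r) = ∑ i, hA.eigenvalues i ^ r := by
  rw [trR, mpow, hA.cfc_eq, IsHermitian.cfc, Unitary.conjStarAlgAut_apply, trace_mul_comm,
    ← mul_assoc]
  simp [Matrix.trace]

/-- Matrices of the form `Tᴴ * T` and `T * Tᴴ` have the same traces of powers. -/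
theorem trR_mpow_conjTranspose_mul_self (T : Matrix ι ι ℂ) (r : ℝ) :
    trR (mpow (Tᴴ * T) r) = trR (mpow (T * Tᴴ) r) := by
  have h₁ := isHermitian_conjTranspose_mul_self T
  have h₂ := isHermitian_mul_conjTranspose_self T
  rw [trR_mpow h₁, trR_mpow h₂,
    (IsHermitian.eigenvalues_eq_eigenvalues_iff h₁ h₂).2 (charpoly_mul_comm _ _)]

theorem trR_pos {κ : Type*} [Fintype κ] [Nonempty κ] {A : Matrix κ κ ℂ} (hA : A.PosDef) : 0 < trR A :=
  (Complex.pos_iff.1 hA.trace_pos).1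

/-- The trace pairing of two functions of Hermitian matrices, intertwined by `S`, is a sum
over pairs of eigenvalues with nonnegative weights that do not depend on the functions. -/
theorem exists_weights_trR {M C : Matrix ι ι ℂ} (hM : M.IsHermitian) (hC : C.IsHermitian)
    (S : Matrix ι ι ℂ) :
    ∃ w : ι × ι → ℝ, (∀ k, 0 ≤ w k) ∧ ∀ f g : ℝ → ℝ,
      trR (Sᴴ * cfc f M * S * cfc g C) =
        ∑ k, w k * (f (hM.eigenvalues k.1) * g (hC.eigenvalues k.2)) := by
  set U : Matrix ι ι ℂ := (hM.eigenvectorUnitary : Matrix ι ι ℂ) with hU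
  set V : Matrix ι ι ℂ := (hC.eigenvectorUnitary : Matrix ι ι ℂ) with hV
  refine ⟨fun k => Complex.normSq ((Uᴴ * S * V) k.1 k.2), fun k => Complex.normSq_nonneg _,
    fun f g => ?_⟩
  set T := Uᴴ * S * V with hT
  set D : Matrix ι ι ℂ := diagonal (RCLike.ofReal ∘ f ∘ hM.eigenvalues) with hD
  set E : Matrix ι ι ℂ := diagonal (RCLike.ofReal ∘ g ∘ hC.eigenvalues) with hE
  have key : (Sᴴ * cfc f M * S * cfc g C).trace = (Tᴴ * D * T * E).trace := by
    rw [hM.cfc_eq, hC.cfc_eq, IsHermitian.cfc, IsHermitian.cfc, Unitary.conjStarAlgAut_apply,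
      Unitary.conjStarAlgAut_apply, ← hU, ← hV, ← hD, ← hE]
    simp only [hT, conjTranspose_mul, conjTranspose_conjTranspose, star_eq_conjTranspose]
    rw [← mul_assoc, trace_mul_comm]
    simp only [mul_assoc]
  rw [trR, key, Fintype.sum_prod_type, Finset.sum_comm]
  simp only [Matrix.trace, diag_apply, hE, mul_diagonal, Complex.re_sum]
  refine Finset.sum_congr rfl fun j _ => ?_
  simp only [hD, mul_apply (M := Tᴴ * _), mul_diagonal, Finset.sum_mul, Complex.re_sum]
  refine Finset.sum_congr rfl fun i _ => ?_
  simp only [conjTranspose_apply, Function.comp_apply, Complex.normSq_apply, Complex.star_def,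
    Complex.coe_algebraMap, Complex.mul_re, Complex.mul_im, Complex.conj_re, Complex.conj_im,
    Complex.ofReal_re, Complex.ofReal_im]
  ring

theorem sum_mul_rpow_le_rpow_mul_rpow {κ : Type*} (s : Finset κ) {w x y : κ → ℝ}
    (hw : ∀ k, 0 ≤ w k) (hx : ∀ k, 0 ≤ x k) (hy : ∀ k, 0 ≤ y k) {a b : ℝ} (ha : 0 < a)
    (hb : 0 < b) (hab : a + b = 1) :
    ∑ k ∈ s, w k * (x k ^ a * y k ^ b) ≤
      (∑ k ∈ s, w k * x k) ^ a * (∑ k ∈ s, w k * y k) ^ b := by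
  have hpq : Real.HolderConjugate a⁻¹ b⁻¹ := Real.holderConjugate_iff.2
    ⟨(one_lt_inv₀ ha).2 (by linarith), by simpa using hab⟩
  have h := Real.inner_le_Lp_mul_Lq_of_nonneg s hpq
    (f := fun k => (w k * x k) ^ a) (g := fun k => (w k * y k) ^ b)
    (fun k _ => by have := hw k; have := hx k; positivity)
    (fun k _ => by have := hw k; have := hy k; positivity)
  simp only [one_div, inv_inv] at h
  refine (Finset.sum_le_sum fun k _ => ?_).trans (h.trans (le_of_eq ?_))
  · rw [Real.mul_rpow (hw k) (hx k), Real.mul_rpow (hw k) (hy k)]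
    have : w k = w k ^ a * w k ^ b := by
      rcases (hw k).eq_or_lt with h0 | h0
      · rw [← h0, Real.zero_rpow ha.ne', zero_mul]
      · rw [← Real.rpow_add h0, hab, Real.rpow_one]
    refine le_of_eq ?_
    nth_rewrite 1 [this]
    ring
  · congr 2 <;> refine Finset.sum_congr rfl fun k _ => ?_
    · exact Real.rpow_rpow_inv (mul_nonneg (hw k) (hx k)) ha.ne'
    · exact Real.rpow_rpow_inv (mul_nonneg (hw k) (hy k)) hb.ne'

theorem trR_mul_mpow_interpolation {M C : Matrix ι ι ℂ} (hM : M.PosDef) (hC : C.PosDef)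
    (S : Matrix ι ι ℂ) {a b : ℝ} (ha : 0 < a) (hb : 0 < b) (hab : a + b = 1) (u v : ℝ) :
    trR (Sᴴ * mpow M b * S * mpow C (a * u + b * v)) ≤
      trR (Sᴴ * S * mpow C u) ^ a * trR (Sᴴ * M * S * mpow C v) ^ b := by
  obtain ⟨w, hw, h⟩ := exists_weights_trR hM.1 hC.1 S
  have h₁ := h (fun x => x ^ b) (fun x => x ^ (a * u + b * v))
  have h₂ := h (fun x => x ^ (0 : ℝ)) (fun x => x ^ u)
  have h₃ := h (fun x => x ^ (1 : ℝ)) (fun x => x ^ v)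
  have e₀ := mpow_zero hM
  have e₁ := mpow_one hM
  rw [mpow] at e₀ e₁
  rw [e₀, mul_one] at h₂
  rw [e₁] at h₃
  rw [mpow, mpow, mpow, mpow, h₁, h₂, h₃]
  refine le_trans (le_of_eq ?_) (sum_mul_rpow_le_rpow_mul_rpow _ hw (fun k => ?_) (fun k => ?_)
    ha hb hab)
  · refine Finset.sum_congr rfl fun k _ => ?_
    have hm := hM.eigenvalues_pos k.1
    have hc := hC.eigenvalues_pos k.2
    rw [Real.rpow_zero, one_mul, Real.rpow_one, Real.mul_rpow hm.le (Real.rpow_nonneg hc.le _),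
      ← Real.rpow_mul hc.le, ← Real.rpow_mul hc.le, Real.rpow_add hc]
    ring_nf
  · have hm := hM.eigenvalues_pos k.1
    have hc := hC.eigenvalues_pos k.2
    positivity
  · have hm := hM.eigenvalues_pos k.1
    have hc := hC.eigenvalues_pos k.2
    positivity

theorem mpow_mul_mpow_neg {A : Matrix ι ι ℂ} (hA : A.PosDef) (r : ℝ) :
    mpow A r * mpow A (-r) = 1 := by
  rw [mpow_mul_mpow hA, add_neg_cancel, mpow_zero hA]

theorem mpow_neg_mul_mpow {A : Matrix ι ι ℂ} (hA : A.PosDef) (r : ℝ) :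
    mpow A (-r) * mpow A r = 1 := by
  rw [mpow_mul_mpow hA, neg_add_cancel, mpow_zero hA]

theorem isUnit_mpow {A : Matrix ι ι ℂ} (hA : A.PosDef) (r : ℝ) : IsUnit (mpow A r) :=
  (mpow_posDef hA r).isUnit

theorem posDef_conjTranspose_mul_mul {A S : Matrix ι ι ℂ} (hA : A.PosDef) (hS : IsUnit S) :
    (Sᴴ * A * S).PosDef :=
  hA.conjTranspose_mul_mul_same (mulVec_injective_of_isUnit hS)

theorem posDef_mpow_mul_mul_mpow {A B : Matrix ι ι ℂ} (hA : A.PosDef) (hB : B.PosDef) (r : ℝ) :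
    (mpow B r * A * mpow B r).PosDef := by
  have h := posDef_conjTranspose_mul_mul hA (isUnit_mpow hB r)
  rwa [(mpow_posDef hB r).1.eq] at h

theorem trR_mul_pos [Nonempty ι] {A B : Matrix ι ι ℂ} (hA : A.PosDef) (hB : B.PosDef) :
    0 < trR (A * B) := by
  have h : trR (A * B) = trR (mpow B (1 / 2) * A * mpow B (1 / 2)) := by
    rw [trR, trR, mul_assoc, trace_mul_comm (mpow B (1 / 2)), mul_assoc, mpow_mul_mpow hB,
      add_halves, mpow_one hB]
  rw [h]
  exact trR_pos (posDef_mpow_mul_mul_mpow hA hB _)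

/-- Hölder's inequality for the trace, in logarithmic form. -/
theorem log_trR_mul_mpow_le [Nonempty ι] {A C : Matrix ι ι ℂ} (hA : A.PosDef) (hC : C.PosDef)
    {t : ℝ} (ht : 0 < t) (ht1 : t < 1) :
    Real.log (trR (A * mpow C (1 - t))) ≤
      t * Real.log (trR (mpow A t⁻¹)) + (1 - t) * Real.log (trR C) := by
  have hA' := mpow_posDef hA t⁻¹
  have h := trR_mul_mpow_interpolation hA' hC 1 (sub_pos.2 ht1) ht (by ring) 1 0
  rw [mpow_mpow hA, inv_mul_cancel₀ ht.ne', mpow_one hA, mpow_one hC, mpow_zero hC] at h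
  simp only [conjTranspose_one, one_mul, mul_one, mul_zero, add_zero] at h
  have h₁ := trR_pos hA'
  have h₂ := trR_pos hC
  have h₃ := Real.log_le_log (trR_mul_pos hA (mpow_posDef hC (1 - t))) h
  rw [Real.log_mul (by positivity) (by positivity), Real.log_rpow h₁, Real.log_rpow h₂] at h₃
  linarith

/-- Interpolation of Schatten norms along a path of weighted matrix geometric means. -/
theorem log_trR_mpow_interpolation [Nonempty ι] {M S : Matrix ι ι ℂ} (hM : M.PosDef)
    (hS : IsUnit S) {a b t₀ t₁ : ℝ} (ha : 0 < a) (hb : 0 < b) (hab : a + b = 1)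
    (ht₀ : 0 < t₀) (ht₀' : t₀ < 1) (ht₁ : 0 < t₁) (ht₁' : t₁ < 1) :
    (a * t₀ + b * t₁) *
        Real.log (trR (mpow (Sᴴ * mpow M b * S) (a * t₀ + b * t₁)⁻¹)) ≤
      a * (t₀ * Real.log (trR (mpow (Sᴴ * S) t₀⁻¹))) +
        b * (t₁ * Real.log (trR (mpow (Sᴴ * M * S) t₁⁻¹))) := by
  set t := a * t₀ + b * t₁ with ht
  have htpos : 0 < t := by positivity
  set X := Sᴴ * mpow M b * S with hX
  have hXp : X.PosDef := posDef_conjTranspose_mul_mul (mpow_posDef hM b) hS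
  have hAp : (Sᴴ * S).PosDef := by
    simpa using posDef_conjTranspose_mul_mul (PosDef.one (n := ι) (R := ℂ)) hS
  have hBp : (Sᴴ * M * S).PosDef := posDef_conjTranspose_mul_mul hM hS
  set C := mpow X t⁻¹ with hC
  have hCp : C.PosDef := mpow_posDef hXp _
  have hXC : X * mpow C (1 - t) = C := by
    rw [hC, mpow_mpow hXp]
    nth_rewrite 1 [← mpow_one hXp]
    rw [mpow_mul_mpow hXp]
    congr 1
    field_simp
    ring
  have h := trR_mul_mpow_interpolation hM hCp S ha hb hab (1 - t₀) (1 - t₁)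
  rw [show a * (1 - t₀) + b * (1 - t₁) = 1 - t by rw [ht]; linear_combination hab, ← hX,
    hXC] at h
  have hA' := trR_mul_pos hAp (mpow_posDef hCp (1 - t₀))
  have hB' := trR_mul_pos hBp (mpow_posDef hCp (1 - t₁))
  have hlog := Real.log_le_log (trR_pos hCp) h
  rw [Real.log_mul (by positivity) (by positivity), Real.log_rpow hA', Real.log_rpow hB'] at hlog
  have hA'' := mul_le_mul_of_nonneg_left (log_trR_mul_mpow_le hAp hCp ht₀ ht₀') ha.le
  have hB'' := mul_le_mul_of_nonneg_left (log_trR_mul_mpow_le hBp hCp ht₁ ht₁') hb.le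
  have e : a * ((1 - t₀) * Real.log (trR C)) + b * ((1 - t₁) * Real.log (trR C)) =
      (1 - t) * Real.log (trR C) := by
    rw [ht]; linear_combination Real.log (trR C) * hab
  linarith

theorem trR_eq_one {κ : Type*} [Fintype κ] {A : Matrix κ κ ℂ} (hA : A.trace = 1) : trR A = 1 := by
  rw [trR, hA, Complex.one_re]

theorem Dsand_nonneg {d : ℕ} [Nonempty (Fin d)] {α : ℝ} (hα : 1 < α)
    {ρ σ : Matrix (Fin d) (Fin d) ℂ} (hρ : ρ.PosDef) (hρ1 : ρ.trace = 1) (hσ : σ.PosDef)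
    (hσ1 : σ.trace = 1) : 0 ≤ Dsand α ρ σ := by
  have hα0 : 0 < α := by linarith
  set r := (1 - α) / (2 * α) with hr
  have hXp := posDef_mpow_mul_mul_mpow hρ hσ r
  have h := log_trR_mul_mpow_le hXp hσ (inv_pos.2 hα0) (inv_lt_one_of_one_lt₀ hα)
  have e : (mpow σ r * ρ * mpow σ r * mpow σ (1 - α⁻¹)).trace = ρ.trace := by
    have hr' : r + (1 - α⁻¹) = -r := by rw [hr]; field_simp; ring
    rw [mul_assoc, mpow_mul_mpow hσ, hr', mul_assoc, trace_mul_comm, mul_assoc,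
      mpow_neg_mul_mpow hσ, mul_one]
  rw [trR_eq_one (e.trans hρ1), trR_eq_one hσ1, Real.log_one, mul_zero, add_zero, inv_inv] at h
  rw [Dsand]
  exact mul_nonneg (one_div_nonneg.2 (by linarith)) (nonneg_of_mul_nonneg_right h (by positivity))

/-- The logarithm of the Schatten norm of order `1 / (1 + s)` of `W ^ (1/2) * σ ^ s * W ^ (1/2)`. -/
noncomputable def logSchatten (s : ℝ) (W σ : Matrix ι ι ℂ) : ℝ :=
  (1 + s) * Real.log (trR (mpow (mpow W (1 / 2) * mpow σ s * mpow W (1 / 2)) (1 + s)⁻¹))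

theorem mul_Dsand_eq {d : ℕ} {s : ℝ} (hs : s ∈ Set.Ioo (-1 : ℝ) 0)
    {W σ : Matrix (Fin d) (Fin d) ℂ} (hW : W.PosDef) (hσ : σ.PosDef) :
    s * Dsand (1 / (1 + s)) W σ = -logSchatten s W σ := by
  have h1 : 1 + s ≠ 0 := by linarith [hs.1]
  have h0 : s ≠ 0 := hs.2.ne
  have hr : (1 - 1 / (1 + s)) / (2 * (1 / (1 + s))) = s / 2 := by field_simp; ring
  have hc : 1 / (1 / (1 + s) - 1) = -((1 + s) / s) := by
    have : 1 / (1 + s) - 1 = -(s / (1 + s)) := by field_simp; ring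
    rw [this, one_div, inv_neg, inv_div]
  have hT := trR_mpow_conjTranspose_mul_self (mpow W (1 / 2) * mpow σ (s / 2)) (1 + s)⁻¹
  have e₁ : (mpow W (1 / 2) * mpow σ (s / 2))ᴴ * (mpow W (1 / 2) * mpow σ (s / 2)) =
      mpow σ (s / 2) * W * mpow σ (s / 2) := by
    rw [conjTranspose_mul, (mpow_posDef hW _).1.eq, (mpow_posDef hσ _).1.eq, ← mul_assoc,
      mul_assoc (mpow σ (s / 2)) (mpow W (1 / 2)), mpow_mul_mpow hW, add_halves, mpow_one hW]
  have e₂ : (mpow W (1 / 2) * mpow σ (s / 2)) * (mpow W (1 / 2) * mpow σ (s / 2))ᴴ =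
      mpow W (1 / 2) * mpow σ s * mpow W (1 / 2) := by
    rw [conjTranspose_mul, (mpow_posDef hW _).1.eq, (mpow_posDef hσ _).1.eq, ← mul_assoc,
      mul_assoc (mpow W (1 / 2)) (mpow σ (s / 2)), mpow_mul_mpow hσ, add_halves]
  rw [e₁, e₂] at hT
  rw [Dsand, hr, hc, one_div, hT, logSchatten]
  field_simp

theorem exists_logSchatten_le [Nonempty ι] {σ₀ σ₁ : Matrix ι ι ℂ} (hσ₀ : σ₀.PosDef)
    (hσ₀' : σ₀.trace = 1) (hσ₁ : σ₁.PosDef) (hσ₁' : σ₁.trace = 1) {s₀ s₁ a b : ℝ}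
    (hs₀ : s₀ ∈ Set.Ioo (-1 : ℝ) 0) (hs₁ : s₁ ∈ Set.Ioo (-1 : ℝ) 0) (ha : 0 < a) (hb : 0 < b)
    (hab : a + b = 1) :
    ∃ σ : Matrix ι ι ℂ, (σ.PosDef ∧ σ.trace = 1) ∧ ∀ W : Matrix ι ι ℂ, W.PosDef →
      logSchatten (a * s₀ + b * s₁) W σ ≤
        a * logSchatten s₀ W σ₀ + b * logSchatten s₁ W σ₁ := by
  obtain ⟨hs₀l, hs₀r⟩ := hs₀
  obtain ⟨hs₁l, hs₁r⟩ := hs₁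
  set s := a * s₀ + b * s₁ with hs
  have hsneg : s < 0 := by nlinarith
  set R := mpow σ₀ (s₀ / 2) with hR
  set Q := mpow σ₀ (-(s₀ / 2)) with hQ
  have hRQ : R * Q = 1 := mpow_mul_mpow_neg hσ₀ _
  have hQR : Q * R = 1 := mpow_neg_mul_mpow hσ₀ _
  have hRH : Rᴴ = R := (mpow_posDef hσ₀ _).1.eq
  have hQH : Qᴴ = Q := (mpow_posDef hσ₀ _).1.eq
  have hRR : R * R = mpow σ₀ s₀ := by rw [hR, mpow_mul_mpow hσ₀, add_halves]
  have hQQ : Q * Q = mpow σ₀ (-s₀) := by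
    rw [hQ, mpow_mul_mpow hσ₀, ← neg_add, add_halves]
  set M := Q * mpow σ₁ s₁ * Q with hM
  have hMp : M.PosDef := posDef_mpow_mul_mul_mpow (mpow_posDef hσ₁ _) hσ₀ _
  have hRMR : R * M * R = mpow σ₁ s₁ := by
    calc R * M * R = (R * Q) * mpow σ₁ s₁ * (Q * R) := by rw [hM]; noncomm_ring
      _ = _ := by rw [hRQ, hQR, one_mul, mul_one]
  have hMinv : mpow M (-1) = R * mpow σ₁ (-s₁) * R := by
    refine left_inv_eq_right_inv (a := M) ?_ ?_
    · simpa only [mpow_one hMp] using mpow_neg_mul_mpow hMp 1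
    · calc M * (R * mpow σ₁ (-s₁) * R)
          = Q * mpow σ₁ s₁ * (Q * R) * mpow σ₁ (-s₁) * R := by rw [hM]; noncomm_ring
        _ = Q * (mpow σ₁ s₁ * mpow σ₁ (-s₁)) * R := by rw [hQR]; noncomm_ring
        _ = 1 := by rw [mpow_mul_mpow_neg hσ₁, mul_one, hQR]
  have hQMQ : Q * mpow M (-1) * Q = mpow σ₁ (-s₁) := by
    calc Q * mpow M (-1) * Q = (Q * R) * mpow σ₁ (-s₁) * (R * Q) := by
          rw [hMinv]; noncomm_ring
      _ = _ := by rw [hRQ, hQR, one_mul, mul_one]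
  set G := R * mpow M b * R with hG
  have hGp : G.PosDef := posDef_mpow_mul_mul_mpow (mpow_posDef hMp _) hσ₀ _
  have hGinv : mpow G (-1) = Q * mpow (mpow M (-1)) b * Q := by
    refine left_inv_eq_right_inv (a := G) ?_ ?_
    · simpa only [mpow_one hGp] using mpow_neg_mul_mpow hGp 1
    · rw [mpow_mpow hMp, neg_one_mul]
      calc G * (Q * mpow M (-b) * Q)
          = R * mpow M b * (R * Q) * mpow M (-b) * Q := by rw [hG]; noncomm_ring
        _ = R * (mpow M b * mpow M (-b)) * Q := by rw [hRQ]; noncomm_ring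
        _ = 1 := by rw [mpow_mul_mpow_neg hMp, mul_one, hRQ]
  set ω := mpow G s⁻¹ with hω
  have hωp : ω.PosDef := mpow_posDef hGp _
  have hωs : mpow ω s = G := by
    rw [hω, mpow_mpow hGp, inv_mul_cancel₀ hsneg.ne, mpow_one hGp]
  set τ := trR ω with hτ
  have hτpos : 0 < τ := trR_pos hωp
  have hτle : Real.log τ ≤ 0 := by
    have h := log_trR_mpow_interpolation (mpow_posDef hMp (-1)) (isUnit_mpow hσ₀ (-(s₀ / 2)))
      ha hb hab (neg_pos.2 hs₀r) (by linarith) (neg_pos.2 hs₁r) (by linarith)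
    rw [← hQ, hQH, hQQ, hQMQ, ← hGinv, mpow_mpow hσ₀, mpow_mpow hσ₁, mpow_mpow hGp,
      mul_inv_cancel₀ (by linarith), mul_inv_cancel₀ (by linarith), mpow_one hσ₀, mpow_one hσ₁,
      trR_eq_one hσ₀', trR_eq_one hσ₁', Real.log_one,
      show a * -s₀ + b * -s₁ = -s by rw [hs]; ring,
      show -1 * (-s)⁻¹ = s⁻¹ by rw [inv_neg]; ring] at h
    simp only [mul_zero, add_zero] at h
    exact nonpos_of_mul_nonpos_right h (neg_pos.2 hsneg)
  have hστ : mpow (τ⁻¹ • ω) s = τ ^ (-s) • G := by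
    rw [mpow_smul hωp (inv_nonneg.2 hτpos.le), hωs, Real.inv_rpow hτpos.le,
      Real.rpow_neg hτpos.le]
  refine ⟨τ⁻¹ • ω, ⟨hωp.smul (inv_pos.2 hτpos), ?_⟩, fun W hW => ?_⟩
  · have him : ω.trace = (τ : ℂ) := by
      have := (Complex.pos_iff.1 hωp.trace_pos).2
      apply Complex.ext
      · rfl
      · simpa using this.symm
    rw [trace_smul, him, Complex.real_smul, ← Complex.ofReal_mul, inv_mul_cancel₀ hτpos.ne',
      Complex.ofReal_one]
  · set K := mpow W (1 / 2) with hK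
    have hKH : Kᴴ = K := (mpow_posDef hW _).1.eq
    have h := log_trR_mpow_interpolation hMp
      ((isUnit_mpow hσ₀ (s₀ / 2)).mul (isUnit_mpow hW (1 / 2)))
      ha hb hab (t₀ := 1 + s₀) (t₁ := 1 + s₁) (by linarith) (by linarith) (by linarith)
      (by linarith)
    have conj (N : Matrix ι ι ℂ) : (R * K)ᴴ * N * (R * K) = K * (R * N * R) * K := by
      rw [conjTranspose_mul, hRH, hKH]; noncomm_ring
    have hone : (R * K)ᴴ * (R * K) = K * mpow σ₀ s₀ * K := by
      rw [← hRR, conjTranspose_mul, hRH, hKH]; noncomm_ring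
    rw [← hR, ← hK, conj, conj, hone, hRMR, ← hG,
      show a * (1 + s₀) + b * (1 + s₁) = 1 + s by rw [hs]; linear_combination hab] at h
    have hs1 : 0 < 1 + s := by nlinarith
    have hKGp : (K * G * K).PosDef := posDef_mpow_mul_mul_mpow hGp hW _
    have hpos := trR_pos (mpow_posDef hKGp (1 + s)⁻¹)
    have hτs : 0 < τ ^ (-s) := Real.rpow_pos_of_pos hτpos _
    have hsmul : trR (mpow (K * (τ ^ (-s) • G) * K) (1 + s)⁻¹) =
        (τ ^ (-s)) ^ (1 + s)⁻¹ * trR (mpow (K * G * K) (1 + s)⁻¹) := by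
      rw [mul_smul_comm, smul_mul_assoc, mpow_smul hKGp hτs.le, trR, trR, trace_smul,
        Complex.smul_re, smul_eq_mul]
    rw [logSchatten, logSchatten, logSchatten, ← hK, hστ, hsmul,
      Real.log_mul (by positivity) hpos.ne', Real.log_rpow hτs, Real.log_rpow hτpos, mul_add,
      mul_inv_cancel_left₀ hs1.ne']
    have := mul_nonpos_of_nonneg_of_nonpos (neg_nonneg.2 hsneg.le) hτle
    linarith

theorem nonempty_dens {d : ℕ} (hd : 0 < d) : Nonempty (Dens d) := by
  have hd' : (0 : ℝ) < d := Nat.cast_pos.2 hd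
  refine ⟨⟨(d : ℝ)⁻¹ • 1, PosDef.one.smul (inv_pos.2 hd'), ?_⟩⟩
  rw [trace_smul, trace_one, Fintype.card_fin, Complex.real_smul]
  push_cast
  exact inv_mul_cancel₀ (by exact_mod_cast hd'.ne')

end

/-- concavity of the sandwiched Augustin auxiliary function
`E₀^{(2),*}(s,P) = s·I^{(2),*}_{1/(1+s)}(P,W)` on `(-1,0)`. -/
theorem sandwiched_augustin_auxiliary_concave {d n : ℕ} (hd : 0 < d) (hn : 0 < n)
    (W : Fin n → Matrix (Fin d) (Fin d) ℂ)
    (hW : ∀ i, (W i).PosDef ∧ (W i).trace = 1)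
    (P : Fin n → ℝ) (hP : ∀ i, 0 ≤ P i) (hP1 : ∑ i, P i = 1) :
    ConcaveOn ℝ (Set.Ioo (-1 : ℝ) 0)
      (fun s => s * sandwichedAugustinInfo (1 / (1 + s)) W P) := by
  have : Nonempty (Fin d) := ⟨⟨0, hd⟩⟩
  have := nonempty_dens hd
  rw [concaveOn_iff_forall_pos]
  refine ⟨convex_Ioo _ _, fun s₀ hs₀ s₁ hs₁ a b ha hb hab => ?_⟩
  have hs := convex_Ioo (-1 : ℝ) 0 hs₀ hs₁ ha.le hb.le hab
  simp only [smul_eq_mul] at hs ⊢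
  set s := a * s₀ + b * s₁ with hsdef
  have hbdd : BddBelow (Set.range fun σ : Dens d =>
      ∑ i, P i * Dsand (1 / (1 + s)) (W i) σ.1) := by
    refine ⟨0, ?_⟩
    rintro _ ⟨σ, rfl⟩
    refine Finset.sum_nonneg fun i _ => mul_nonneg (hP i) ?_
    have hα : 1 < 1 / (1 + s) := one_lt_one_div (by linarith [hs.1]) (by linarith [hs.2])
    exact Dsand_nonneg hα (hW i).1 (hW i).2 σ.2.1 σ.2.2
  have hsum (r : ℝ) (hr : r ∈ Set.Ioo (-1 : ℝ) 0) (σ : Dens d) :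
      r * ∑ i, P i * Dsand (1 / (1 + r)) (W i) σ.1 =
        -∑ i, P i * logSchatten r (W i) σ.1 := by
    rw [Finset.mul_sum, ← Finset.sum_neg_distrib]
    refine Finset.sum_congr rfl fun i _ => ?_
    rw [mul_left_comm, mul_Dsand_eq hr (hW i).1 σ.2.1, mul_neg]
  have key (σ₀ σ₁ : Dens d) :
      a * s₀ * ∑ i, P i * Dsand (1 / (1 + s₀)) (W i) σ₀.1 +
          b * s₁ * ∑ i, P i * Dsand (1 / (1 + s₁)) (W i) σ₁.1 ≤
        s * sandwichedAugustinInfo (1 / (1 + s)) W P := by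
    obtain ⟨σ, hσ, h⟩ := exists_logSchatten_le σ₀.2.1 σ₀.2.2 σ₁.2.1 σ₁.2.2 hs₀ hs₁ ha hb hab
    have hle := mul_le_mul_of_nonpos_left (ciInf_le hbdd ⟨σ, hσ⟩) hs.2.le
    rw [hsum s hs ⟨σ, hσ⟩] at hle
    refine le_trans ?_ hle
    rw [mul_assoc, mul_assoc, hsum s₀ hs₀, hsum s₁ hs₁]
    have hle' := Finset.sum_le_sum fun i (_ : i ∈ Finset.univ) =>
      mul_le_mul_of_nonneg_left (h (W i) (hW i).1) (hP i)
    have e : ∑ i, P i * (a * logSchatten s₀ (W i) σ₀.1 + b * logSchatten s₁ (W i) σ₁.1) =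
        a * ∑ i, P i * logSchatten s₀ (W i) σ₀.1 + b * ∑ i, P i * logSchatten s₁ (W i) σ₁.1 := by
      rw [Finset.mul_sum, Finset.mul_sum, ← Finset.sum_add_distrib]
      exact Finset.sum_congr rfl fun i _ => by ring
    rw [e] at hle'
    linarith
  have hbound {c r K : ℝ} (hc : c * r ≤ 0) (h : ∀ σ : Dens d,
      c * r * ∑ i, P i * Dsand (1 / (1 + r)) (W i) σ.1 ≤ K) :
      c * (r * sandwichedAugustinInfo (1 / (1 + r)) W P) ≤ K := by
    rw [← mul_assoc, sandwichedAugustinInfo, Real.mul_iInf_of_nonpos hc]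
    exact ciSup_le h
  rw [← le_sub_iff_add_le]
  refine hbound (mul_nonpos_of_nonneg_of_nonpos ha.le hs₀.2.le) fun σ₀ => ?_
  rw [le_sub_comm]
  refine hbound (mul_nonpos_of_nonneg_of_nonpos hb.le hs₁.2.le) fun σ₁ => ?_
  rw [le_sub_iff_add_le']
  exact key σ₀ σ₁
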